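/- arXiv:2308.12366 — 2 statements merged into one kernel-verified Lean document; each statement's English description precedes it below -/
import Mathlib

section
/- Let X be a measurable space, Y a type, and let μ_s, μ_u, μ_h be probability measures on X (the seen, unseen, and generated-unseen distributions) with labeling functions f_s, f_u, f_h : X → Y. Let H be a nonempty set of functions X → Y whose pairwise disagreement sets (and disagreement sets with f_s, f_u, f_h) are measurable. Then for every h ∈ H and every h* ∈ H, writing λ := ε_{μ_s}(h*, f_s) + ε_{μ_h}(h*, f_h) and d_{h*}(μ_h, μ_u) := |ε_{μ_h}(h*, f_h) − ε_{μ_u}(h*, f_u)|, one has ε_{μ_u}(h, f_u) ≤ ε_{μ_s}(h, f_s) + (1/2)·d_{HΔH}(μ_s, μ_u) + λ + d_{h*}(μ_h, μ_u). -/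
open MeasureTheory

/-- The risk of hypothesis `h` against labeling function `f` under measure `μ`:
the measure of the disagreement set. -/
noncomputable def risk {X Y : Type*} [MeasurableSpace X] (μ : Measure X) (h f : X → Y) : ℝ :=
  (μ {x | h x ≠ f x}).toReal

/-- The HΔH-distance between two measures, relative to a hypothesis class `H`. -/
noncomputable def dHH {X Y : Type*} [MeasurableSpace X] (H : Set (X → Y))
    (μ ν : Measure X) : ℝ :=
  2 * sSup { r : ℝ | ∃ h ∈ H, ∃ h' ∈ H, r = |risk μ h h' - risk ν h h'| }

theorem risk_comm {X Y : Type*} [MeasurableSpace X] (μ : Measure X) (f g : X → Y) :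
    risk μ f g = risk μ g f := by
  simp only [risk, ne_comm]

theorem risk_triangle {X Y : Type*} [MeasurableSpace X] (μ : Measure X) [IsFiniteMeasure μ]
    (f g k : X → Y) : risk μ f k ≤ risk μ f g + risk μ g k := by
  have hsub : {x | f x ≠ k x} ⊆ {x | f x ≠ g x} ∪ {x | g x ≠ k x} := fun x hx => by
    by_contra hn
    simp only [Set.mem_union, Set.mem_ofPred_eq, not_or, not_not] at hn
    exact hx (hn.1.trans hn.2)
  exact (measureReal_mono hsub).trans (measureReal_union_le _ _)

theorem abs_risk_sub_le_half_dHH {X Y : Type*} [MeasurableSpace X] (μ ν : Measure X)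
    [IsProbabilityMeasure μ] [IsProbabilityMeasure ν] {H : Set (X → Y)} {g k : X → Y}
    (hg : g ∈ H) (hk : k ∈ H) : |risk μ g k - risk ν g k| ≤ (1 / 2) * dHH H μ ν := by
  have hbdd : BddAbove {r : ℝ | ∃ h ∈ H, ∃ h' ∈ H, r = |risk μ h h' - risk ν h h'|} := by
    refine ⟨1, ?_⟩
    rintro r ⟨a, -, b, -, rfl⟩
    have hμ₀ : 0 ≤ risk μ a b := ENNReal.toReal_nonneg
    have hν₀ : 0 ≤ risk ν a b := ENNReal.toReal_nonneg
    have hμ₁ : risk μ a b ≤ 1 := measureReal_le_one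
    have hν₁ : risk ν a b ≤ 1 := measureReal_le_one
    exact abs_sub_le_iff.2 ⟨by linarith, by linarith⟩
  have hle := le_csSup hbdd ⟨g, hg, k, hk, rfl⟩
  unfold dHH
  linarith

theorem expected_generalization_bound
    {X Y : Type*} [MeasurableSpace X]
    (μs μu μh : Measure X)
    [IsProbabilityMeasure μs] [IsProbabilityMeasure μu] [IsProbabilityMeasure μh]
    (fs fu fh : X → Y)
    (H : Set (X → Y)) (hHne : H.Nonempty)
    (hmeasHH : ∀ g ∈ H, ∀ g' ∈ H, MeasurableSet {x | g x ≠ g' x})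
    (hmeas_s : ∀ g ∈ H, MeasurableSet {x | g x ≠ fs x})
    (hmeas_u : ∀ g ∈ H, MeasurableSet {x | g x ≠ fu x})
    (hmeas_h : ∀ g ∈ H, MeasurableSet {x | g x ≠ fh x})
    (h hstar : X → Y) (hhH : h ∈ H) (hstarH : hstar ∈ H) :
    risk μu h fu ≤
      risk μs h fs + (1 / 2) * dHH H μs μu
        + (risk μs hstar fs + risk μh hstar fh)
        + |risk μh hstar fh - risk μu hstar fu| := by
  have hu := risk_triangle μu h hstar fu
  have hs := risk_triangle μs h fs hstar
  rw [risk_comm μs fs hstar] at hs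
  have hd := (abs_le.1 (abs_risk_sub_le_half_dHH μs μu hhH hstarH)).1
  have hh := neg_abs_le (risk μh hstar fh - risk μu hstar fu)
  linarith
end

section
/- Let X be a measurable space, Y a type, μ_s, μ_u, μ_h probability measures on X with labeling functions f_s, f_u, f_h : X → Y, and H a nonempty set of functions X → Y whose pairwise disagreement sets (and disagreement sets with f_s, f_u, f_h) are measurable. Let S_s, S_h, S_u be nonempty finite samples of points of X, let h, ĥ* ∈ H, and let c ≥ 0 be such that the following four deviation bounds hold: |ε_{μ_s}(h, f_s) − ε̂_{S_s}(h, f_s)| ≤ c, |ε_{μ_s}(ĥ*, f_s) − ε̂_{S_s}(ĥ*, f_s)| ≤ c, |ε_{μ_h}(ĥ*, f_h) − ε̂_{S_h}(ĥ*, f_h)| ≤ c, and |ε_{μ_u}(ĥ*, f_u) − ε̂_{S_u}(ĥ*, f_u)| ≤ c. Then, writing λ̄ := ε̂_{S_s}(ĥ*, f_s) + ε̂_{S_h}(ĥ*, f_h) and d̄_GDB(S_u, S_h) := |ε̂_{S_u}(ĥ*, f_u) − ε̂_{S_h}(ĥ*, f_h)|, one has ε_{μ_u}(h, f_u) ≤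 ε̂_{S_s}(h, f_s) + (1/2)·d_{HΔH}(μ_s, μ_u) + λ̄ + d̄_GDB(S_u, S_h) + 5c. -/
open MeasureTheory

-- The empirical risk of hypothesis `h` against labeling function `f` on a finite sample `S`.
open Classical in
noncomputable def empRisk {X Y : Type*} (S : Finset X) (h f : X → Y) : ℝ :=
  ((S.filter fun x => h x ≠ f x).card : ℝ) / (S.card : ℝ)

theorem abs_risk_sub_le_dHH {X Y : Type*} [MeasurableSpace X] {H : Set (X → Y)}
    (μ ν : Measure X) [IsProbabilityMeasure μ] [IsProbabilityMeasure ν]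
    {f g : X → Y} (hf : f ∈ H) (hg : g ∈ H) :
    |risk μ f g - risk ν f g| ≤ (1 / 2) * dHH H μ ν := by
  have hbdd : BddAbove {r : ℝ | ∃ h ∈ H, ∃ h' ∈ H, r = |risk μ h h' - risk ν h h'|} := by
    refine ⟨1, ?_⟩
    rintro r ⟨h, -, h', -, rfl⟩
    exact abs_sub_le_of_nonneg_of_le measureReal_nonneg measureReal_le_one
      measureReal_nonneg measureReal_le_one
  have hle := le_csSup hbdd ⟨f, hf, g, hg, rfl⟩
  unfold dHH
  linarith

theorem empirical_generalization_bound
    {X Y : Type*} [MeasurableSpace X]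
    (μs μu μh : Measure X)
    [IsProbabilityMeasure μs] [IsProbabilityMeasure μu] [IsProbabilityMeasure μh]
    (fs fu fh : X → Y)
    (H : Set (X → Y)) (hHne : H.Nonempty)
    (hmeasHH : ∀ g ∈ H, ∀ g' ∈ H, MeasurableSet {x | g x ≠ g' x})
    (hmeas_s : ∀ g ∈ H, MeasurableSet {x | g x ≠ fs x})
    (hmeas_u : ∀ g ∈ H, MeasurableSet {x | g x ≠ fu x})
    (hmeas_h : ∀ g ∈ H, MeasurableSet {x | g x ≠ fh x})
    (Ss Sh Su : Finset X) (hSs : Ss.Nonempty) (hSh : Sh.Nonempty) (hSu : Su.Nonempty)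
    (h hhat : X → Y) (hhH : h ∈ H) (hhatH : hhat ∈ H)
    (c : ℝ) (hc : 0 ≤ c)
    (hdev1 : |risk μs h fs - empRisk Ss h fs| ≤ c)
    (hdev2 : |risk μs hhat fs - empRisk Ss hhat fs| ≤ c)
    (hdev3 : |risk μh hhat fh - empRisk Sh hhat fh| ≤ c)
    (hdev4 : |risk μu hhat fu - empRisk Su hhat fu| ≤ c) :
    risk μu h fu ≤
      empRisk Ss h fs + (1 / 2) * dHH H μs μu
        + (empRisk Ss hhat fs + empRisk Sh hhat fh)
        + |empRisk Su hhat fu - empRisk Sh hhat fh|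
        + 5 * c := by
  have hu := risk_triangle μu h hhat fu
  have hs := risk_triangle μs h fs hhat
  rw [risk_comm μs fs hhat] at hs
  have hd := abs_risk_sub_le_dHH μs μu hhH hhatH
  have hgap := le_abs_self (empRisk Su hhat fu - empRisk Sh hhat fh)
  linarith [(abs_le.mp hd).1, (abs_le.mp hdev1).2, (abs_le.mp hdev2).2, (abs_le.mp hdev4).2]
end
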